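/- Let p, T > 0, let f : [0,p]×[−T,T] → ℝ, and let u₁, u₂ : ℝ² → ℝ both be continuous on [0,p]×[−T,T], with all partial derivatives up to second order in x and in t existing and continuous on Ω⁺ = (0,p)×(0,T) and on Ω⁻ = (0,p)×(−T,0), and both satisfying: (i) u_tt − u_xx = f on Ω⁺ and u_t + u_xx = f on Ω⁻; (ii) u(0,t) = u(p,t) = 0 for all t ∈ (−T,T); (iii) for each x ∈ (0,p), the one-sided limits as t → 0⁺ and t → 0⁻ of u, u_t, u_tt exist and coincide pairwise; (iv) for each t ∈ (−T,T)∖{0}, lim_{x→0⁺} x·u_x(x,t) = 0 and lim_{x→p⁻} (p−x)·u_x(x,t) = 0. Then u₁ = u₂ on [0,p]×[−T,T]. -/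

import Mathlib

open Set Filter Topology

/-- `u` is a solution of the boundary value problem for the mixed
parabolic-hyperbolic equation `u_tt - u_xx = f` (t > 0), `u_t + u_xx = f` (t < 0)
in the rectangle `(0,p) × (-T,T)`, with the boundary, conjugation and
regularity conditions of the problem. -/
def IsMixedSol (p T : ℝ) (f : ℝ → ℝ → ℝ) (u : ℝ → ℝ → ℝ) : Prop :=
  -- continuity of `u` on the closed rectangle
  ContinuousOn (fun q : ℝ × ℝ => u q.1 q.2) (Icc 0 p ×ˢ Icc (-T) T) ∧
  -- existence of the partial derivatives u_x, u_t, u_xx, u_tt on Ω⁺ ∪ Ω⁻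
  (∀ q : ℝ × ℝ, q ∈ (Ioo 0 p ×ˢ Ioo 0 T) ∪ (Ioo 0 p ×ˢ Ioo (-T) (0:ℝ)) →
    DifferentiableAt ℝ (fun y => u y q.2) q.1 ∧
    DifferentiableAt ℝ (fun s => u q.1 s) q.2 ∧
    DifferentiableAt ℝ (deriv (fun y => u y q.2)) q.1 ∧
    DifferentiableAt ℝ (deriv (fun s => u q.1 s)) q.2) ∧
  -- continuity of the partial derivatives on Ω⁺ ∪ Ω⁻
  ContinuousOn (fun q : ℝ × ℝ => deriv (fun y => u y q.2) q.1)
    ((Ioo 0 p ×ˢ Ioo 0 T) ∪ (Ioo 0 p ×ˢ Ioo (-T) (0:ℝ))) ∧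
  ContinuousOn (fun q : ℝ × ℝ => deriv (fun s => u q.1 s) q.2)
    ((Ioo 0 p ×ˢ Ioo 0 T) ∪ (Ioo 0 p ×ˢ Ioo (-T) (0:ℝ))) ∧
  ContinuousOn (fun q : ℝ × ℝ => deriv (deriv (fun y => u y q.2)) q.1)
    ((Ioo 0 p ×ˢ Ioo 0 T) ∪ (Ioo 0 p ×ˢ Ioo (-T) (0:ℝ))) ∧
  ContinuousOn (fun q : ℝ × ℝ => deriv (deriv (fun s => u q.1 s)) q.2)
    ((Ioo 0 p ×ˢ Ioo 0 T) ∪ (Ioo 0 p ×ˢ Ioo (-T) (0:ℝ))) ∧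
  -- (i) the equation: u_tt - u_xx = f on Ω⁺, u_t + u_xx = f on Ω⁻
  (∀ x ∈ Ioo (0:ℝ) p, ∀ t ∈ Ioo (0:ℝ) T,
    deriv (deriv (fun s => u x s)) t - deriv (deriv (fun y => u y t)) x = f x t) ∧
  (∀ x ∈ Ioo (0:ℝ) p, ∀ t ∈ Ioo (-T) (0:ℝ),
    deriv (fun s => u x s) t + deriv (deriv (fun y => u y t)) x = f x t) ∧
  -- (ii) boundary conditions
  (∀ t ∈ Ioo (-T) T, u 0 t = 0 ∧ u p t = 0) ∧
  -- (iii) conjugation conditions: both one-sided limits exist and coincide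
  (∀ x ∈ Ioo (0:ℝ) p,
    (∃ L : ℝ, Tendsto (fun t => u x t) (𝓝[>] 0) (𝓝 L) ∧
      Tendsto (fun t => u x t) (𝓝[<] 0) (𝓝 L)) ∧
    (∃ L : ℝ, Tendsto (fun t => deriv (fun s => u x s) t) (𝓝[>] 0) (𝓝 L) ∧
      Tendsto (fun t => deriv (fun s => u x s) t) (𝓝[<] 0) (𝓝 L)) ∧
    (∃ L : ℝ, Tendsto (fun t => deriv (deriv (fun s => u x s)) t) (𝓝[>] 0) (𝓝 L) ∧
      Tendsto (fun t => deriv (deriv (fun s => u x s)) t) (𝓝[<] 0) (𝓝 L))) ∧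
  -- (iv) regularity conditions at the lateral boundary
  (∀ t ∈ Ioo (-T) T, t ≠ 0 →
    Tendsto (fun x => x * deriv (fun y => u y t) x) (𝓝[>] 0) (𝓝 0) ∧
    Tendsto (fun x => (p - x) * deriv (fun y => u y t) x) (𝓝[<] p) (𝓝 0))

/-- The alternating sum of `w` over the vertices of the characteristic rectangle of the wave
equation with bottom vertex `(x, t)` and side displacements `(a, a)` and `(-b, b)`. -/
def charDefect (w : ℝ → ℝ → ℝ) (x t a b : ℝ) : ℝ :=
  w x t - w (x + a) (t + a) - w (x - b) (t + b) + w (x + a - b) (t + a + b)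

theorem second_difference_le {f f' f'' : ℝ → ℝ} {c h M : ℝ} (hh : 0 ≤ h)
    (hf : ∀ x ∈ Icc (c - h) (c + h), HasDerivAt f (f' x) x)
    (hf' : ∀ x ∈ Icc (c - h) (c + h), HasDerivAt f' (f'' x) x)
    (hM : ∀ x ∈ Icc (c - h) (c + h), f'' x ≤ M) :
    f (c + h) + f (c - h) - 2 * f c ≤ M * h ^ 2 := by
  have anti : AntitoneOn (fun x => f' x - M * x) (Icc (c - h) (c + h)) := by
    have hd : ∀ x ∈ Icc (c - h) (c + h), HasDerivAt (fun x => f' x - M * x) (f'' x - M) x :=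
      fun x hx => ((hf' x hx).sub ((hasDerivAt_id x).const_mul M)).congr_deriv (by simp)
    refine antitoneOn_of_hasDerivWithinAt_nonpos (f' := fun x => f'' x - M) (convex_Icc _ _)
      (fun x hx => (hd x hx).continuousAt.continuousWithinAt)
      (fun x hx => (hd x (interior_subset hx)).hasDerivWithinAt) fun x hx => ?_
    have := hM x (interior_subset hx)
    linarith
  have hk : ∀ s ∈ Icc 0 h, HasDerivAt (fun s => f (c + s) + f (c - s) - M * s ^ 2)
      (f' (c + s) - f' (c - s) - 2 * M * s) s := by
    rintro s ⟨hs0, hsh⟩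
    have h1 := (hf (c + s) ⟨by linarith, by linarith⟩).comp s ((hasDerivAt_id s).const_add c)
    have h2 := (hf (c - s) ⟨by linarith, by linarith⟩).comp s ((hasDerivAt_id s).const_sub c)
    have h3 := ((hasDerivAt_id s).pow 2).const_mul M
    refine ((h1.add h2).sub h3).congr_deriv ?_
    simp
    ring
  have key : AntitoneOn (fun s => f (c + s) + f (c - s) - M * s ^ 2) (Icc 0 h) := by
    refine antitoneOn_of_hasDerivWithinAt_nonpos (convex_Icc _ _)
      (fun x hx => (hk x hx).continuousAt.continuousWithinAt)
      (fun x hx => (hk x (interior_subset hx)).hasDerivWithinAt) fun s hs => ?_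
    obtain ⟨hs0, hsh⟩ := interior_subset hs
    have := anti (a := c - s) (b := c + s) ⟨by linarith, by linarith⟩ ⟨by linarith, by linarith⟩
      (by linarith)
    simp only at this
    linarith
  have := key (left_mem_Icc.2 hh) (right_mem_Icc.2 hh) hh
  simp at this
  linarith

/-- `w` is continuous on `[0, p] × [A, B]`, twice differentiable in each variable inside, and
`w_tt = w_xx = g` there with `g` continuous. -/
structure IsWave (p A B : ℝ) (w wx wt g : ℝ → ℝ → ℝ) : Prop where
  cont : ContinuousOn (fun q : ℝ × ℝ => w q.1 q.2) (Icc 0 p ×ˢ Icc A B)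
  hx : ∀ x ∈ Ioo 0 p, ∀ t ∈ Ioo A B, HasDerivAt (fun y => w y t) (wx x t) x
  hxx : ∀ x ∈ Ioo 0 p, ∀ t ∈ Ioo A B, HasDerivAt (fun y => wx y t) (g x t) x
  ht : ∀ x ∈ Ioo 0 p, ∀ t ∈ Ioo A B, HasDerivAt (fun s => w x s) (wt x t) t
  htt : ∀ x ∈ Ioo 0 p, ∀ t ∈ Ioo A B, HasDerivAt (fun s => wt x s) (g x t) t
  contg : ContinuousOn (fun q : ℝ × ℝ => g q.1 q.2) (Ioo 0 p ×ˢ Ioo A B)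

namespace IsWave

variable {p A B : ℝ} {w wx wt g : ℝ → ℝ → ℝ}

theorem neg (H : IsWave p A B w wx wt g) :
    IsWave p A B (fun x t => -w x t) (fun x t => -wx x t) (fun x t => -wt x t)
      (fun x t => -g x t) where
  cont := H.cont.neg
  hx x hx t ht := (H.hx x hx t ht).neg
  hxx x hx t ht := (H.hxx x hx t ht).neg
  ht x hx t ht := (H.ht x hx t ht).neg
  htt x hx t ht := (H.htt x hx t ht).neg
  contg := H.contg.neg

theorem charDefect_square_le (H : IsWave p A B w wx wt g) {x t h ε : ℝ} (hh : 0 ≤ h)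
    (hx0 : 0 < x - h) (hxp : x + h < p) (ht0 : A < t) (htB : t + 2 * h < B)
    (hε : ∀ y ∈ Icc (x - h) (x + h), ∀ s ∈ Icc t (t + 2 * h), |g y s - g x (t + h)| ≤ ε) :
    charDefect w x t h h ≤ 2 * ε * h ^ 2 := by
  have e1 := second_difference_le (f := fun s => w x s) (f' := fun s => wt x s)
    (f'' := fun s => g x s) (c := t + h) (M := g x (t + h) + ε) hh
    (fun s hs => H.ht x ⟨by linarith, by linarith⟩ s ⟨by linarith [hs.1], by linarith [hs.2]⟩)
    (fun s hs => H.htt x ⟨by linarith, by linarith⟩ s ⟨by linarith [hs.1], by linarith [hs.2]⟩)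
    (fun s hs => by
      have := (abs_le.1 (hε x ⟨by linarith, by linarith⟩ s
        ⟨by linarith [hs.1], by linarith [hs.2]⟩)).2
      linarith)
  have e2 := second_difference_le (f := fun y => -w y (t + h)) (f' := fun y => -wx y (t + h))
    (f'' := fun y => -g y (t + h)) (c := x) (M := -g x (t + h) + ε) hh
    (fun y hy => H.neg.hx y ⟨by linarith [hy.1], by linarith [hy.2]⟩ _
      ⟨by linarith, by linarith⟩)
    (fun y hy => H.neg.hxx y ⟨by linarith [hy.1], by linarith [hy.2]⟩ _
      ⟨by linarith, by linarith⟩)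
    (fun y hy => by
      have := (abs_le.1 (hε y hy (t + h) ⟨by linarith, by linarith⟩)).1
      linarith)
  simp only [charDefect, add_sub_cancel_right] at *
  linarith

theorem abs_charDefect_square_le (H : IsWave p A B w wx wt g) {x t h ε : ℝ} (hh : 0 ≤ h)
    (hx0 : 0 < x - h) (hxp : x + h < p) (ht0 : A < t) (htB : t + 2 * h < B)
    (hε : ∀ y ∈ Icc (x - h) (x + h), ∀ s ∈ Icc t (t + 2 * h), |g y s - g x (t + h)| ≤ ε) :
    |charDefect w x t h h| ≤ 2 * ε * h ^ 2 := by
  refine abs_le.2 ⟨?_, H.charDefect_square_le hh hx0 hxp ht0 htB hε⟩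
  have := H.neg.charDefect_square_le hh hx0 hxp ht0 htB (ε := ε) fun y hy s hs => by
    rw [← abs_neg]
    convert hε y hy s hs using 2
    ring
  simp only [charDefect] at *
  linarith

end IsWave

theorem abs_charDefect_grid_le {w : ℝ → ℝ → ℝ} {x t h C : ℝ} (N M : ℕ)
    (hC : ∀ i < N, ∀ j < M, |charDefect w (x + i * h - j * h) (t + i * h + j * h) h h| ≤ C) :
    |charDefect w x t (N * h) (M * h)| ≤ N * (M * C) := by
  have row : ∀ i < N, ∀ m ≤ M, |charDefect w (x + i * h) (t + i * h) h (m * h)| ≤ m * C := by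
    intro i hi m
    induction m with
    | zero => intro _; simp [charDefect]
    | succ m ih =>
      intro hm
      have h1 := ih (by omega)
      have h2 := hC i hi m (by omega)
      have : charDefect w (x + i * h) (t + i * h) h ((m + 1 : ℕ) * h) =
          charDefect w (x + i * h) (t + i * h) h (m * h) +
          charDefect w (x + i * h - m * h) (t + i * h + m * h) h h := by
        simp only [charDefect]
        push_cast
        ring_nf
      rw [this]
      push_cast
      linarith [abs_add_le (charDefect w (x + i * h) (t + i * h) h (m * h))
        (charDefect w (x + i * h - m * h) (t + i * h + m * h) h h)]
  have col : ∀ n ≤ N, |charDefect w x t (n * h) (M * h)| ≤ n * (M * C) := by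
    intro n
    induction n with
    | zero => intro _; simp [charDefect]
    | succ n ih =>
      intro hn
      have h1 := ih (by omega)
      have h2 := row n (by omega) M le_rfl
      have : charDefect w x t ((n + 1 : ℕ) * h) (M * h) =
          charDefect w x t (n * h) (M * h) +
          charDefect w (x + n * h) (t + n * h) h (M * h) := by
        simp only [charDefect]
        push_cast
        ring_nf
      rw [this]
      push_cast
      linarith [abs_add_le (charDefect w x t (n * h) (M * h))
        (charDefect w (x + n * h) (t + n * h) h (M * h))]
  exact col N le_rfl

namespace IsWave

variable {p A B : ℝ} {w wx wt g : ℝ → ℝ → ℝ}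

theorem continuousOn_charDefect (H : IsWave p A B w wx wt g) {S : Set ℝ} {X Y a b : ℝ → ℝ}
    (hX : Continuous X) (hY : Continuous Y) (ha : Continuous a) (hb : Continuous b)
    (hS : ∀ s ∈ S, 0 ≤ a s ∧ 0 ≤ b s ∧ 0 ≤ X s - b s ∧ X s + a s ≤ p ∧ A ≤ Y s ∧
      Y s + a s + b s ≤ B) :
    ContinuousOn (fun s => charDefect w (X s) (Y s) (a s) (b s)) S := by
  have aux : ∀ P Q : ℝ → ℝ, Continuous P → Continuous Q →
      (∀ s ∈ S, P s ∈ Icc 0 p ∧ Q s ∈ Icc A B) → ContinuousOn (fun s => w (P s) (Q s)) S :=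
    fun P Q hP hQ h => H.cont.comp (f := fun s => (P s, Q s)) (hP.prodMk hQ).continuousOn
      fun s hs => ⟨(h s hs).1, (h s hs).2⟩
  refine (((aux X Y hX hY ?_).sub (aux _ _ (hX.add ha) (hY.add ha) ?_)).sub
    (aux _ _ (hX.sub hb) (hY.add hb) ?_)).add
    (aux _ _ ((hX.add ha).sub hb) ((hY.add ha).add hb) ?_)
  all_goals
    intro s hs
    obtain ⟨h1, h2, h3, h4, h5, h6⟩ := hS s hs
    refine ⟨⟨?_, ?_⟩, ⟨?_, ?_⟩⟩ <;> (try simp only [Pi.add_apply, Pi.sub_apply]) <;> linarith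

theorem charDefect_eq_zero_of_interior (H : IsWave p A B w wx wt g) {x t a b : ℝ} (ha : 0 < a)
    (hb : 0 ≤ b) (hx0 : 0 < x - b) (hxp : x + a < p) (htA : A < t) (htB : t + a + b < B) :
    charDefect w x t a b = 0 := by
  have hK : Icc (x - b) (x + a) ×ˢ Icc t (t + a + b) ⊆ Ioo 0 p ×ˢ Ioo A B :=
    prod_mono (Icc_subset_Ioo hx0 hxp) (Icc_subset_Ioo htA htB)
  have huc := (isCompact_Icc.prod isCompact_Icc).uniformContinuousOn_of_continuous
    (H.contg.mono hK)
  have hlim : Tendsto (fun N : ℕ => (⌊b / a * (N : ℝ)⌋₊ : ℝ) * (a / N)) atTop (𝓝 b) := by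
    have h1 := ((tendsto_nat_floor_mul_div_atTop (R := ℝ) (a := b / a) (by positivity)).comp
      tendsto_natCast_atTop_atTop).mul_const a
    rw [div_mul_cancel₀ _ ha.ne'] at h1
    refine h1.congr fun N => ?_
    simp only [Function.comp_apply]
    ring
  have hle : ∀ N : ℕ, 0 < N → (⌊b / a * (N : ℝ)⌋₊ : ℝ) * (a / N) ≤ b := by
    intro N hN
    have hN' : (0 : ℝ) < N := Nat.cast_pos.2 hN
    calc (⌊b / a * (N : ℝ)⌋₊ : ℝ) * (a / N) ≤ (b / a * N) * (a / N) :=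
          mul_le_mul_of_nonneg_right (Nat.floor_le (by positivity)) (by positivity)
      _ = b := by field_simp
  have hcd : Tendsto (fun N : ℕ => charDefect w x t a ((⌊b / a * (N : ℝ)⌋₊ : ℝ) * (a / N))) atTop
      (𝓝 (charDefect w x t a b)) := by
    have hc := H.continuousOn_charDefect (S := Icc 0 b) (X := fun _ => x) (Y := fun _ => t)
      (a := fun _ => a) (b := fun s => s) continuous_const continuous_const continuous_const
      continuous_id fun s hs => ⟨ha.le, hs.1, by linarith [hs.2], hxp.le, htA.le,
        by linarith [hs.2]⟩
    refine (hc b ⟨hb, le_rfl⟩).tendsto.comp (tendsto_nhdsWithin_iff.2 ⟨hlim, ?_⟩)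
    filter_upwards [eventually_gt_atTop 0] with N hN
    exact ⟨by positivity, hle N hN⟩
  have hbound : ∀ ε > 0, |charDefect w x t a b| ≤ 2 * a * b * ε := by
    intro ε hε
    obtain ⟨δ, hδ, hg⟩ := Metric.uniformContinuousOn_iff_le.1 huc ε hε
    have hsmall : ∀ᶠ N : ℕ in atTop, a / (N : ℝ) < δ :=
      (tendsto_const_div_atTop_nhds_zero_nat a).eventually_lt_const hδ
    refine le_of_tendsto hcd.abs ?_
    filter_upwards [eventually_gt_atTop 0, hsmall] with N hN hNδ
    have hN' : (0 : ℝ) < N := Nat.cast_pos.2 hN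
    have hMb := hle N hN
    set M := ⌊b / a * (N : ℝ)⌋₊
    set h := a / (N : ℝ) with hh
    have hh0 : 0 < h := by positivity
    have hNh : N * h = a := by rw [hh]; field_simp
    have hgrid := abs_charDefect_grid_le (w := w) (x := x) (t := t) (h := h) (C := 2 * ε * h ^ 2)
      N M fun i hi j hj => by
        have hi1 : ((i : ℝ) + 1) * h ≤ a := by
          rw [← hNh]
          exact mul_le_mul_of_nonneg_right (by exact_mod_cast hi) hh0.le
        have hj1 : ((j : ℝ) + 1) * h ≤ b := le_trans
          (mul_le_mul_of_nonneg_right (by exact_mod_cast hj) hh0.le) hMb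
        have hi0 : 0 ≤ (i : ℝ) * h := by positivity
        have hj0 : 0 ≤ (j : ℝ) * h := by positivity
        rw [add_one_mul] at hi1 hj1
        refine H.abs_charDefect_square_le hh0.le (by linarith) (by linarith) (by linarith)
          (by linarith) fun y hy s hs => ?_
        refine hg (y, s) ⟨⟨by linarith [hy.1], by linarith [hy.2]⟩,
          ⟨by linarith [hs.1], by linarith [hs.2]⟩⟩ (_, _) ⟨⟨by linarith, by linarith⟩,
          ⟨by linarith, by linarith⟩⟩ ?_
        rw [Prod.dist_eq, Real.dist_eq, Real.dist_eq]
        refine max_le (abs_le.2 ⟨?_, ?_⟩) (abs_le.2 ⟨?_, ?_⟩) <;> simp only <;>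
          linarith [hy.1, hy.2, hs.1, hs.2]
    rw [hNh] at hgrid
    calc _ ≤ _ := hgrid
      _ = 2 * a * (M * h) * ε := by rw [← hNh]; ring
      _ ≤ 2 * a * b * ε := by gcongr
  by_contra hne
  have hpos := abs_pos.2 hne
  have h1 := hbound (|charDefect w x t a b| / (2 * (2 * a * b + 1))) (by positivity)
  have h2 : 2 * a * b * (|charDefect w x t a b| / (2 * (2 * a * b + 1))) ≤
      |charDefect w x t a b| / 2 := by
    rw [mul_div_assoc', div_le_div_iff₀ (by positivity) (by positivity)]
    nlinarith
  linarith

theorem charDefect_eq_zero (H : IsWave p A B w wx wt g) (hp : 0 < p) (hAB : A < B)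
    {x t a b : ℝ} (ha : 0 ≤ a) (hb : 0 ≤ b) (hx0 : 0 ≤ x - b) (hxp : x + a ≤ p) (htA : A ≤ t)
    (htB : t + a + b ≤ B) : charDefect w x t a b = 0 := by
  rcases ha.eq_or_lt with rfl | ha
  · simp [charDefect]
  have hc := H.continuousOn_charDefect (S := Icc 0 1) (X := fun s => (1 - s) * x + s * (p / 2))
    (Y := fun s => (1 - s) * t + s * ((A + B) / 2)) (a := fun s => (1 - s) * a)
    (b := fun s => (1 - s) * b) (by fun_prop) (by fun_prop) (by fun_prop) (by fun_prop)
    (by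
      rintro s ⟨hs0, hs1⟩
      have hs1 : 0 ≤ 1 - s := by linarith
      refine ⟨by positivity, by positivity, ?_, ?_, ?_, ?_⟩ <;> nlinarith)
  have hzero : (fun s => charDefect w ((1 - s) * x + s * (p / 2))
      ((1 - s) * t + s * ((A + B) / 2)) ((1 - s) * a) ((1 - s) * b)) =ᶠ[𝓝[>] 0] fun _ => 0 := by
    filter_upwards [Ioo_mem_nhdsGT one_pos] with s hs
    have hs1 : 0 < 1 - s := by linarith [hs.2]
    have hs0 := hs.1
    refine H.charDefect_eq_zero_of_interior (by positivity) (by positivity) ?_ ?_ ?_ ?_ <;>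
      nlinarith
  have hlim := ((hc 0 (by simp)).mono_of_mem_nhdsWithin
    (Icc_mem_nhdsGE one_pos)).tendsto.mono_left (nhdsWithin_mono 0 Ioi_subset_Ici_self)
  have := tendsto_nhds_unique hlim (tendsto_const_nhds.congr' hzero.symm)
  simpa using this

end IsWave

theorem hasDerivAt_deriv_of_eqOn_Ioo {φ F F₁ F₂ : ℝ → ℝ} {l r : ℝ} (heq : EqOn φ F (Ioo l r))
    (h₁ : ∀ y ∈ Ioo l r, HasDerivAt F (F₁ y) y) (h₂ : ∀ y ∈ Ioo l r, HasDerivAt F₁ (F₂ y) y) :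
    ∀ y ∈ Ioo l r, HasDerivAt φ (F₁ y) y ∧ HasDerivAt (deriv φ) (F₂ y) y := by
  have key : ∀ y ∈ Ioo l r, HasDerivAt φ (F₁ y) y := fun y hy =>
    (h₁ y hy).congr_of_eventuallyEq (heq.eventuallyEq_of_mem (isOpen_Ioo.mem_nhds hy))
  refine fun y hy => ⟨key y hy, (h₂ y hy).congr_of_eventuallyEq ?_⟩
  filter_upwards [isOpen_Ioo.mem_nhds hy] with z hz using (key z hz).deriv

namespace IsWave

variable {p T : ℝ} {w wx wt g : ℝ → ℝ → ℝ}

theorem continuousAt (H : IsWave p 0 T w wx wt g) {x t : ℝ} (hx : x ∈ Ioo 0 p)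
    (ht : t ∈ Ioo 0 T) : ContinuousAt (fun q : ℝ × ℝ => g q.1 q.2) (x, t) :=
  H.contg.continuousAt ((isOpen_Ioo.prod isOpen_Ioo).mem_nhds ⟨hx, ht⟩)

theorem hasDerivAt_near_bottom (H : IsWave p 0 T w wx wt g) (hp : 0 < p) (hT : 0 < T)
    {τ t : ℝ} (hτ : 0 < τ) (ht : 0 ≤ t) (htT : t + 2 * τ < T) :
    ∀ y ∈ Ioo τ (p - τ),
      HasDerivAt (fun y => w y t)
        (wx (y + τ) (t + τ) + wx (y - τ) (t + τ) - wx y (t + 2 * τ)) y ∧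
      HasDerivAt (deriv fun y => w y t)
        (g (y + τ) (t + τ) + g (y - τ) (t + τ) - g y (t + 2 * τ)) y := by
  refine hasDerivAt_deriv_of_eqOn_Ioo
    (F := fun y => w (y + τ) (t + τ) + w (y - τ) (t + τ) - w y (t + 2 * τ))
    (F₁ := fun y => wx (y + τ) (t + τ) + wx (y - τ) (t + τ) - wx y (t + 2 * τ)) ?_ ?_ ?_
  · rintro y ⟨hy1, hy2⟩
    have := H.charDefect_eq_zero hp hT hτ.le hτ.le (x := y) (t := t) (by linarith) (by linarith)
      ht (by linarith)
    simp only [charDefect, add_sub_cancel_right] at this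
    rw [show t + τ + τ = t + 2 * τ by ring] at this
    simp only
    linarith
  all_goals
    rintro y ⟨hy1, hy2⟩
    have e1 : y + τ ∈ Ioo 0 p := ⟨by linarith, by linarith⟩
    have e2 : y - τ ∈ Ioo 0 p := ⟨by linarith, by linarith⟩
    have e3 : y ∈ Ioo 0 p := ⟨by linarith, by linarith⟩
    have e4 : t + τ ∈ Ioo 0 T := ⟨by linarith, by linarith⟩
    have e5 : t + 2 * τ ∈ Ioo 0 T := ⟨by linarith, by linarith⟩
  · exact (((H.hx _ e1 _ e4).comp_add_const y τ).add ((H.hx _ e2 _ e4).comp_sub_const y τ)).sub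
      (H.hx _ e3 _ e5)
  · exact (((H.hxx _ e1 _ e4).comp_add_const y τ).add ((H.hxx _ e2 _ e4).comp_sub_const y τ)).sub
      (H.hxx _ e3 _ e5)

theorem hasDerivAt_left_corner (H : IsWave p 0 T w wx wt g) (hp : 0 < p) (hT : 0 < T)
    (hw : ∀ t ∈ Ioo 0 T, w 0 t = 0) {a : ℝ} (ha : 0 < a) (hap : 2 * a < p) (haT : 2 * a < T) :
    ∀ y ∈ Ioo 0 a, HasDerivAt (deriv fun y => w y 0) (g (y + a) a - g a (y + a)) y := by
  refine fun y hy => (hasDerivAt_deriv_of_eqOn_Ioo (φ := fun y => w y 0)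
    (F := fun y => w (y + a) a - w a (y + a))
    (F₁ := fun y => wx (y + a) a - wt a (y + a))
    (F₂ := fun y => g (y + a) a - g a (y + a)) ?_ ?_ ?_ y hy).2
  · rintro y ⟨hy1, hy2⟩
    have := H.charDefect_eq_zero hp hT ha.le hy1.le (x := y) (t := 0) (by linarith)
      (by linarith) le_rfl (by linarith)
    simp only [charDefect, sub_self, zero_add, hw y ⟨hy1, by linarith⟩] at this
    rw [show y + a - y = a by ring, show a + y = y + a by ring] at this
    simp only
    linarith
  all_goals
    rintro y ⟨hy1, hy2⟩
    have e1 : y + a ∈ Ioo 0 p := ⟨by linarith, by linarith⟩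
    have e2 : y + a ∈ Ioo 0 T := ⟨by linarith, by linarith⟩
    have e3 : a ∈ Ioo 0 p := ⟨by linarith, by linarith⟩
    have e4 : a ∈ Ioo 0 T := ⟨by linarith, by linarith⟩
  · exact ((H.hx _ e1 _ e4).comp_add_const y a).sub ((H.ht _ e3 _ e2).comp_add_const y a)
  · exact ((H.hxx _ e1 _ e4).comp_add_const y a).sub ((H.htt _ e3 _ e2).comp_add_const y a)

theorem hasDerivAt_right_corner (H : IsWave p 0 T w wx wt g) (hp : 0 < p) (hT : 0 < T)
    (hw : ∀ t ∈ Ioo 0 T, w p t = 0) {a : ℝ} (ha : 0 < a) (hap : 2 * a < p) (haT : 2 * a < T) :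
    ∀ y ∈ Ioo (p - a) p,
      HasDerivAt (deriv fun y => w y 0) (g (y - a) a - g (p - a) (a + p - y)) y := by
  refine fun y hy => (hasDerivAt_deriv_of_eqOn_Ioo (φ := fun y => w y 0)
    (F := fun y => w (y - a) a - w (p - a) (a + p - y))
    (F₁ := fun y => wx (y - a) a + wt (p - a) (a + p - y))
    (F₂ := fun y => g (y - a) a - g (p - a) (a + p - y)) ?_ ?_ ?_ y hy).2
  · rintro y ⟨hy1, hy2⟩
    have := H.charDefect_eq_zero hp hT (a := p - y) (b := a) (x := y) (t := 0) (by linarith)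
      ha.le (by linarith) (by linarith) le_rfl (by linarith)
    simp only [charDefect, zero_add, add_sub_cancel, hw (p - y) ⟨by linarith, by linarith⟩]
      at this
    rw [show p - y + a = a + p - y by ring] at this
    simp only
    linarith
  all_goals
    rintro y ⟨hy1, hy2⟩
    have e1 : y - a ∈ Ioo 0 p := ⟨by linarith, by linarith⟩
    have e2 : a + p - y ∈ Ioo 0 T := ⟨by linarith, by linarith⟩
    have e3 : p - a ∈ Ioo 0 p := ⟨by linarith, by linarith⟩
    have e4 : a ∈ Ioo 0 T := ⟨by linarith, by linarith⟩
  · exact (((H.hx _ e1 _ e4).comp_sub_const y a).sub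
      ((H.ht _ e3 _ e2).comp_const_sub (a + p) y)).congr_deriv (by ring)
  · exact (((H.hxx _ e1 _ e4).comp_sub_const y a).add
      ((H.htt _ e3 _ e2).comp_const_sub (a + p) y)).congr_deriv (by ring)

/-- A solution of the wave equation which vanishes on the lateral boundary is twice differentiable
up to the initial line, and `w_xx` vanishes at the corners. -/
theorem exists_initial_deriv (H : IsWave p 0 T w wx wt g) (hp : 0 < p) (hT : 0 < T)
    (hw0 : ∀ t ∈ Ioo 0 T, w 0 t = 0) (hwp : ∀ t ∈ Ioo 0 T, w p t = 0) :
    ∃ φ₁ φ₂ : ℝ → ℝ, ContinuousOn φ₂ (Icc 0 p) ∧ φ₂ 0 = 0 ∧ φ₂ p = 0 ∧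
      (∀ x ∈ Ioo 0 p, HasDerivAt (fun y => w y 0) (φ₁ x) x ∧ HasDerivAt φ₁ (φ₂ x) x) ∧
      ∀ x ∈ Ioo 0 p, Tendsto (fun q : ℝ × ℝ => g q.1 q.2) (𝓝 x ×ˢ 𝓝[>] 0) (𝓝 (φ₂ x)) := by
  classical
  set φ₁ := deriv fun y => w y 0 with hφ₁
  set φ₂ : ℝ → ℝ := fun x => if x ∈ Ioo 0 p then deriv φ₁ x else 0 with hφ₂
  have in_φ₂ : ∀ x ∈ Ioo 0 p, φ₂ x = deriv φ₁ x := fun x hx => by simp only [hφ₂, if_pos hx]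
  have h0 : φ₂ 0 = 0 := by simp [hφ₂]
  have hp0 : φ₂ p = 0 := by simp [hφ₂]
  have hτ : ∀ x ∈ Ioo 0 p, ∃ τ, 0 < τ ∧ 2 * τ < T ∧ x ∈ Ioo τ (p - τ) := by
    rintro x ⟨hx0, hxp⟩
    refine ⟨min (min x (p - x)) T / 3, ?_, ?_, ?_, ?_⟩
    · have : 0 < p - x := by linarith
      positivity
    · linarith [min_le_right (min x (p - x)) T]
    · linarith [min_le_left (min x (p - x)) T, min_le_left x (p - x)]
    · linarith [min_le_left (min x (p - x)) T, min_le_right x (p - x)]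
  have hG : ∀ τ, 0 < τ → 2 * τ < T → ∀ x ∈ Ioo τ (p - τ), ContinuousAt (fun q : ℝ × ℝ =>
      g (q.1 + τ) (q.2 + τ) + g (q.1 - τ) (q.2 + τ) - g q.1 (q.2 + 2 * τ)) (x, 0) := by
    rintro τ hτ hτT x ⟨hx1, hx2⟩
    refine (ContinuousAt.add ?_ ?_).sub ?_
    · exact ContinuousAt.comp' (g := fun q : ℝ × ℝ => g q.1 q.2)
        (f := fun q : ℝ × ℝ => (q.1 + τ, q.2 + τ))
        (H.continuousAt ⟨by linarith, by linarith⟩ ⟨by simpa, by simp only; linarith⟩)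
        (by fun_prop)
    · exact ContinuousAt.comp' (g := fun q : ℝ × ℝ => g q.1 q.2)
        (f := fun q : ℝ × ℝ => (q.1 - τ, q.2 + τ))
        (H.continuousAt ⟨by linarith, by linarith⟩ ⟨by simpa, by simp only; linarith⟩)
        (by fun_prop)
    · exact ContinuousAt.comp' (g := fun q : ℝ × ℝ => g q.1 q.2)
        (f := fun q : ℝ × ℝ => (q.1, q.2 + 2 * τ))
        (H.continuousAt ⟨by linarith, by linarith⟩ ⟨by simpa, by simp only; linarith⟩)
        (by fun_prop)
  have hmain : ∀ x ∈ Ioo 0 p, HasDerivAt (fun y => w y 0) (φ₁ x) x ∧ HasDerivAt φ₁ (φ₂ x) x := by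
    intro x hx
    obtain ⟨τ, hτ0, hτT, hxτ⟩ := hτ x hx
    have := H.hasDerivAt_near_bottom hp hT hτ0 le_rfl (by linarith) x hxτ
    refine ⟨this.1.differentiableAt.hasDerivAt, ?_⟩
    rw [in_φ₂ x hx]
    exact this.2.differentiableAt.hasDerivAt
  obtain ⟨a, ha, hap, haT⟩ : ∃ a, 0 < a ∧ 2 * a < p ∧ 2 * a < T :=
    ⟨min p T / 3, by positivity, by linarith [min_le_left p T], by linarith [min_le_right p T]⟩
  refine ⟨φ₁, φ₂, ?_, h0, hp0, hmain, ?_⟩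
  · rintro x ⟨hx0, hxp⟩
    rcases hx0.eq_or_lt with rfl | hx0
    · have hlim : Tendsto (fun y => g (y + a) a - g a (y + a)) (𝓝[>] 0) (𝓝 (φ₂ 0)) := by
        rw [h0]
        have hc : ContinuousAt (fun y => g (y + a) a - g a (y + a)) 0 := by
          refine ContinuousAt.sub ?_ ?_
          · exact ContinuousAt.comp' (g := fun q : ℝ × ℝ => g q.1 q.2)
              (f := fun y : ℝ => (y + a, a))
              (H.continuousAt ⟨by linarith, by linarith⟩ ⟨by linarith, by linarith⟩)
              (by fun_prop)
          · exact ContinuousAt.comp' (g := fun q : ℝ × ℝ => g q.1 q.2)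
              (f := fun y : ℝ => (a, y + a))
              (H.continuousAt ⟨by linarith, by linarith⟩ ⟨by linarith, by linarith⟩)
              (by fun_prop)
        simpa using hc.tendsto.mono_left nhdsWithin_le_nhds
      have : ContinuousWithinAt φ₂ (Ioi 0) 0 := by
        refine hlim.congr' ?_
        filter_upwards [Ioo_mem_nhdsGT ha] with y hy
        rw [in_φ₂ y ⟨hy.1, by linarith [hy.2]⟩]
        exact (H.hasDerivAt_left_corner hp hT hw0 ha hap haT y hy).deriv.symm
      exact (continuousWithinAt_Ioi_iff_Ici.1 this).mono fun y hy => hy.1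
    rcases hxp.eq_or_lt with rfl | hxp
    · have hlim : Tendsto (fun y => g (y - a) a - g (x - a) (a + x - y)) (𝓝[<] x)
          (𝓝 (φ₂ x)) := by
        rw [hp0]
        have hc : ContinuousAt (fun y => g (y - a) a - g (x - a) (a + x - y)) x := by
          refine ContinuousAt.sub ?_ ?_
          · exact ContinuousAt.comp' (g := fun q : ℝ × ℝ => g q.1 q.2)
              (f := fun y : ℝ => (y - a, a))
              (H.continuousAt ⟨by linarith, by linarith⟩ ⟨by linarith, by linarith⟩)
              (by fun_prop)
          · exact ContinuousAt.comp' (g := fun q : ℝ × ℝ => g q.1 q.2)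
              (f := fun y : ℝ => (x - a, a + x - y))
              (H.continuousAt ⟨by linarith, by linarith⟩ ⟨by linarith, by linarith⟩)
              (by fun_prop)
        simpa using hc.tendsto.mono_left nhdsWithin_le_nhds
      have : ContinuousWithinAt φ₂ (Iio x) x := by
        refine hlim.congr' ?_
        filter_upwards [Ioo_mem_nhdsLT (show x - a < x by linarith)] with y hy
        rw [in_φ₂ y ⟨by linarith [hy.1], hy.2⟩]
        exact (H.hasDerivAt_right_corner hp hT hwp ha hap haT y hy).deriv.symm
      exact (continuousWithinAt_Iio_iff_Iic.1 this).mono fun y hy => hy.2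
    · obtain ⟨τ, hτ0, hτT, hxτ⟩ := hτ x ⟨hx0, hxp⟩
      have hc := (hG τ hτ0 hτT x hxτ).comp' (f := fun y : ℝ => (y, (0 : ℝ))) (by fun_prop)
      refine (hc.congr ?_).continuousWithinAt
      filter_upwards [isOpen_Ioo.mem_nhds hxτ] with y hy
      rw [in_φ₂ y ⟨by linarith [hy.1], by linarith [hy.2]⟩]
      exact (H.hasDerivAt_near_bottom hp hT hτ0 le_rfl (by linarith) y hy).2.deriv.symm
  · intro x hx
    obtain ⟨τ, hτ0, hτT, hxτ⟩ := hτ x hx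
    have hc := (hG τ hτ0 hτT x hxτ).tendsto
    have hval : φ₂ x = g (x + τ) (0 + τ) + g (x - τ) (0 + τ) - g x (0 + 2 * τ) := by
      rw [in_φ₂ x hx]
      exact (H.hasDerivAt_near_bottom hp hT hτ0 le_rfl (by linarith) x hxτ).2.deriv
    rw [hval]
    have hle : 𝓝 x ×ˢ 𝓝[>] (0 : ℝ) ≤ 𝓝 (x, 0) := by
      rw [nhds_prod_eq]
      exact Filter.prod_mono le_rfl nhdsWithin_le_nhds
    refine (hc.mono_left hle).congr' ?_
    have hmem : Ioo τ (p - τ) ×ˢ Ioo 0 (T - 2 * τ) ∈ 𝓝 x ×ˢ 𝓝[>] (0 : ℝ) :=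
      prod_mem_prod (isOpen_Ioo.mem_nhds hxτ) (Ioo_mem_nhdsGT (by linarith))
    filter_upwards [hmem] with q hq
    obtain ⟨⟨hq1, hq2⟩, hq3, hq4⟩ := hq
    have hd : deriv (fun y => w y q.2) =ᶠ[𝓝 q.1] fun y => wx y q.2 := by
      filter_upwards [isOpen_Ioo.mem_nhds (show q.1 ∈ Ioo 0 p from
        ⟨by linarith, by linarith⟩)] with y hy
      exact (H.hx y hy q.2 ⟨hq3, by linarith⟩).deriv
    have h1 := (H.hasDerivAt_near_bottom hp hT hτ0 hq3.le (by linarith) q.1 ⟨hq1, hq2⟩).2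
    exact (h1.congr_of_eventuallyEq hd.symm).unique
      (H.hxx q.1 ⟨by linarith, by linarith⟩ q.2 ⟨hq3, by linarith⟩)

end IsWave

theorem hasDerivAt_zero_extension {f f' : ℝ → ℝ} {T : ℝ} (hT : 0 < T)
    (hf : ∀ t ∈ Ioo 0 T, HasDerivAt f (f' t) t) (hf0 : Tendsto f (𝓝[>] 0) (𝓝 0))
    (hf'0 : Tendsto f' (𝓝[>] 0) (𝓝 0)) {t : ℝ} (ht : t < T) :
    HasDerivAt (fun s => if s ≤ 0 then 0 else f s) (if t ≤ 0 then 0 else f' t) t := by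
  have hpos : ∀ t ∈ Ioo 0 T, HasDerivAt (fun s => if s ≤ 0 then 0 else f s) (f' t) t := by
    intro t ht
    refine (hf t ht).congr_of_eventuallyEq ?_
    filter_upwards [Ioi_mem_nhds ht.1] with s hs
    exact if_neg (not_le.2 hs)
  rcases lt_trichotomy t 0 with h | rfl | h
  · rw [if_pos h.le]
    refine (hasDerivAt_const t (0 : ℝ)).congr_of_eventuallyEq ?_
    filter_upwards [Iio_mem_nhds h] with s hs
    exact if_pos (le_of_lt hs)
  · rw [if_pos le_rfl]
    have hl : HasDerivWithinAt (fun s => if s ≤ 0 then 0 else f s) 0 (Iic 0) 0 :=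
      (hasDerivWithinAt_const 0 _ (0 : ℝ)).congr (fun s hs => if_pos hs) (if_pos le_rfl)
    have hr : HasDerivWithinAt (fun s => if s ≤ 0 then 0 else f s) 0 (Ici 0) 0 := by
      refine hasDerivWithinAt_Ici_of_tendsto_deriv (s := Ioo 0 T)
        (fun s hs => (hpos s hs).differentiableAt.differentiableWithinAt) ?_
        (Ioo_mem_nhdsGT hT) ?_
      · have : Tendsto (fun s => if s ≤ 0 then 0 else f s) (𝓝[>] 0) (𝓝 0) := by
          refine hf0.congr' ?_
          filter_upwards [self_mem_nhdsWithin] with s hs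
          exact (if_neg (not_le.2 hs)).symm
        have h2 := this.mono_left (nhdsWithin_mono 0 fun s (hs : s ∈ Ioo 0 T) => hs.1)
        simpa [ContinuousWithinAt] using h2
      · refine hf'0.congr' ?_
        filter_upwards [Ioo_mem_nhdsGT hT] with s hs
        exact (hpos s hs).deriv.symm
    have := hl.union hr
    rwa [Iic_union_Ici, hasDerivWithinAt_univ] at this
  · rw [if_neg (not_le.2 h)]
    exact hpos t ⟨h, ht⟩

namespace IsWave

variable {p T : ℝ} {w wx wt g : ℝ → ℝ → ℝ}

theorem zero_extension (H : IsWave p 0 T w wx wt g) (hT : 0 < T)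
    (hφ : ∀ x ∈ Icc 0 p, w x 0 = 0) (hψ : ∀ x ∈ Ioo 0 p, Tendsto (wt x) (𝓝[>] 0) (𝓝 0))
    (hχ : ∀ x ∈ Ioo 0 p, Tendsto (fun q : ℝ × ℝ => g q.1 q.2) (𝓝 x ×ˢ 𝓝[>] 0) (𝓝 0)) (A : ℝ) :
    IsWave p A T (fun x t => if t ≤ 0 then 0 else w x t) (fun x t => if t ≤ 0 then 0 else wx x t)
      (fun x t => if t ≤ 0 then 0 else wt x t) (fun x t => if t ≤ 0 then 0 else g x t) where
  cont := by
    have hm : MapsTo (fun q : ℝ × ℝ => (q.1, max q.2 0)) (Icc 0 p ×ˢ Icc A T)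
        (Icc 0 p ×ˢ Icc 0 T) := fun q hq => ⟨hq.1, le_max_right _ _, max_le hq.2.2 hT.le⟩
    refine (H.cont.comp (f := fun q : ℝ × ℝ => (q.1, max q.2 0)) (by fun_prop) hm).congr ?_
    intro q hq
    by_cases h : q.2 ≤ 0
    · simp [h, hφ q.1 hq.1]
    · simp [h, max_eq_left (not_le.1 h).le]
  hx x hx t ht := by
    by_cases h : t ≤ 0
    · simp only [if_pos h]
      exact hasDerivAt_const x 0
    · simp only [if_neg h]
      exact H.hx x hx t ⟨not_le.1 h, ht.2⟩
  hxx x hx t ht := by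
    by_cases h : t ≤ 0
    · simp only [if_pos h]
      exact hasDerivAt_const x 0
    · simp only [if_neg h]
      exact H.hxx x hx t ⟨not_le.1 h, ht.2⟩
  ht x hx t ht := by
    refine hasDerivAt_zero_extension hT (H.ht x hx) ?_ (hψ x hx) ht.2
    have hc := H.cont.comp (f := fun s : ℝ => (x, s)) (s := Icc 0 T) (by fun_prop)
      fun s hs => ⟨Ioo_subset_Icc_self hx, hs⟩
    have := ((hc 0 (left_mem_Icc.2 hT.le)).mono_of_mem_nhdsWithin
      (Icc_mem_nhdsGE hT)).tendsto.mono_left (nhdsWithin_mono 0 Ioi_subset_Ici_self)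
    simpa [hφ x (Ioo_subset_Icc_self hx), Function.comp_def] using this
  htt x hx t ht := by
    refine hasDerivAt_zero_extension hT (H.htt x hx) (hψ x hx) ?_ ht.2
    exact (hχ x hx).comp (tendsto_const_nhds.prodMk tendsto_id)
  contg := by
    rintro ⟨x, t⟩ ⟨hx, ht⟩
    refine ContinuousAt.continuousWithinAt ?_
    rcases lt_trichotomy t 0 with h | rfl | h
    · refine (continuousAt_const (y := (0 : ℝ))).congr ?_
      filter_upwards [continuous_snd.continuousAt.eventually (Iio_mem_nhds h)] with q hq
      exact (if_pos (le_of_lt hq)).symm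
    · have hval : (if ((x, (0 : ℝ)) : ℝ × ℝ).2 ≤ 0 then 0 else g x 0) = 0 := if_pos le_rfl
      have hle : 𝓝 x ×ˢ 𝓝 (0 : ℝ) = 𝓝 x ×ˢ 𝓝[≤] 0 ⊔ 𝓝 x ×ˢ 𝓝[>] 0 := by
        rw [← prod_sup, nhdsLE_sup_nhdsGT]
      rw [ContinuousAt, hval, nhds_prod_eq, hle]
      refine Tendsto.sup ?_ ?_
      · refine (tendsto_const_nhds (x := (0 : ℝ))).congr' ?_
        filter_upwards [prod_mem_prod univ_mem self_mem_nhdsWithin] with q hq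
        exact (if_pos hq.2).symm
      · refine (hχ x hx).congr' ?_
        filter_upwards [prod_mem_prod univ_mem self_mem_nhdsWithin] with q hq
        exact (if_neg (not_le.2 hq.2)).symm
    · refine (H.continuousAt hx ⟨h, ht.2⟩).congr ?_
      filter_upwards [continuous_snd.continuousAt.eventually (Ioi_mem_nhds h)] with q hq
      exact (if_neg (not_le.2 hq)).symm

/-- Uniqueness for the mixed problem of the wave equation. -/
theorem eq_zero (H : IsWave p 0 T w wx wt g) (hp : 0 < p) (hT : 0 < T)
    (hw0 : ∀ t ∈ Ioo 0 T, w 0 t = 0) (hwp : ∀ t ∈ Ioo 0 T, w p t = 0)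
    (hφ : ∀ x ∈ Icc 0 p, w x 0 = 0) (hψ : ∀ x ∈ Ioo 0 p, Tendsto (wt x) (𝓝[>] 0) (𝓝 0))
    (hχ : ∀ x ∈ Ioo 0 p, Tendsto (fun q : ℝ × ℝ => g q.1 q.2) (𝓝 x ×ˢ 𝓝[>] 0) (𝓝 0)) :
    ∀ x ∈ Ioo 0 p, ∀ t ∈ Ioo 0 T, w x t = 0 := by
  have HW := H.zero_extension hT hφ hψ hχ (-p)
  set W : ℝ → ℝ → ℝ := fun x t => if t ≤ 0 then 0 else w x t with hW
  have Wneg : ∀ x t, t ≤ 0 → W x t = 0 := fun x t ht => if_pos ht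
  have Wpos : ∀ x t, 0 < t → W x t = w x t := fun x t ht => if_neg (not_le.2 ht)
  have W0 : ∀ t < T, W 0 t = 0 := fun t ht => by
    rcases le_or_gt t 0 with h | h
    · exact Wneg _ _ h
    · rw [Wpos _ _ h, hw0 t ⟨h, ht⟩]
  have Wp : ∀ t < T, W p t = 0 := fun t ht => by
    rcases le_or_gt t 0 with h | h
    · exact Wneg _ _ h
    · rw [Wpos _ _ h, hwp t ⟨h, ht⟩]
  have key : ∀ n : ℕ, ∀ x ∈ Ioo 0 p, ∀ t < T, t ≤ n * p → W x t = 0 := by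
    intro n
    induction n with
    | zero => exact fun x _ t _ ht => Wneg x t (by simpa using ht)
    | succ n ih =>
      rintro x ⟨hx0, hxp⟩ t htT ht
      rcases le_or_gt t 0 with h | h
      · exact Wneg _ _ h
      have hrect := HW.charDefect_eq_zero hp (by linarith) (x := p - x) (t := t - p) (a := x)
        (b := p - x) hx0.le (by linarith) (by linarith) (by linarith) (by linarith) (by linarith)
      have h1 := ih (p - x) ⟨by linarith, by linarith⟩ (t - p) (by linarith)
        (by push_cast at ht; linarith)
      rw [charDefect, h1, sub_add_cancel, sub_self, Wp _ (by linarith), W0 _ (by linarith)] at hrect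
      rw [show p - (p - x) = x by ring, show t - p + x + (p - x) = t by ring] at hrect
      linarith
  intro x hx t ht
  obtain ⟨n, hn⟩ := exists_nat_ge (t / p)
  rw [← Wpos x t ht.1]
  exact key n x hx t ht.2 ((div_le_iff₀ hp).1 hn)

end IsWave

theorem deriv_nonpos_of_le_right {f : ℝ → ℝ} {f' t : ℝ} (hf : HasDerivAt f f' t)
    (h : ∀ᶠ s in 𝓝[>] t, f s ≤ f t) : f' ≤ 0 := by
  have hlim := (hasDerivWithinAt_iff_tendsto_slope' (s := Ioi t) (by simp)).1
    hf.hasDerivWithinAt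
  refine le_of_tendsto hlim ?_
  filter_upwards [h, self_mem_nhdsWithin] with s hs hts
  rw [slope_def_field]
  exact div_nonpos_of_nonpos_of_nonneg (by linarith) (sub_nonneg.2 (le_of_lt hts))

theorem IsLocalMax.second_deriv_nonpos {f f' : ℝ → ℝ} {f'' x : ℝ} (hmax : IsLocalMax f x)
    (hf : ∀ᶠ y in 𝓝 x, HasDerivAt f (f' y) y) (hf' : HasDerivAt f' f'' x) : f'' ≤ 0 := by
  by_contra! hpos
  have hd : deriv f =ᶠ[𝓝 x] f' := hf.mono fun y hy => hy.deriv
  have hdd : deriv (deriv f) x = f'' := (hf'.congr_of_eventuallyEq hd).deriv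
  have hmin := isLocalMin_of_deriv_deriv_pos (by rwa [hdd]) hmax.deriv_eq_zero
    hf.self_of_nhds.continuousAt
  have hconst : f =ᶠ[𝓝 x] fun _ => f x := by
    filter_upwards [hmax, hmin] with y h1 h2 using le_antisymm h1 h2
  have : deriv (deriv f) x = 0 := by
    rw [hconst.deriv.deriv_eq]
    simp
  linarith

/-- Weak maximum principle for subsolutions of the backward heat equation. -/
theorem backward_heat_nonpos {p T : ℝ} {d dx dt dxx : ℝ → ℝ → ℝ}
    (cont : ContinuousOn (fun q : ℝ × ℝ => d q.1 q.2) (Icc 0 p ×ˢ Icc (-T) 0))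
    (hx : ∀ x ∈ Ioo 0 p, ∀ t ∈ Ioo (-T) 0, HasDerivAt (fun y => d y t) (dx x t) x)
    (hxx : ∀ x ∈ Ioo 0 p, ∀ t ∈ Ioo (-T) 0, HasDerivAt (fun y => dx y t) (dxx x t) x)
    (ht : ∀ x ∈ Ioo 0 p, ∀ t ∈ Ioo (-T) 0, HasDerivAt (fun s => d x s) (dt x t) t)
    (hsub : ∀ x ∈ Ioo 0 p, ∀ t ∈ Ioo (-T) 0, 0 ≤ dt x t + dxx x t)
    (h0 : ∀ x ∈ Icc 0 p, d x 0 ≤ 0) (hl : ∀ t ∈ Ioo (-T) 0, d 0 t ≤ 0)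
    (hr : ∀ t ∈ Ioo (-T) 0, d p t ≤ 0) :
    ∀ x ∈ Icc 0 p, ∀ t ∈ Ioo (-T) 0, d x t ≤ 0 := by
  intro x₁ hx₁ t₁ ht₁
  by_contra! hpos
  set ε := d x₁ t₁ / (2 * (-t₁)) with hε
  have ht₁0 : 0 < -t₁ := by linarith [ht₁.2]
  have hε0 : 0 < ε := by positivity
  have hεt : ε * t₁ = -(d x₁ t₁ / 2) := by
    have : t₁ ≠ 0 := by linarith
    rw [hε]
    field_simp
  have hK : Icc 0 p ×ˢ Icc t₁ 0 ⊆ Icc 0 p ×ˢ Icc (-T) 0 :=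
    prod_mono le_rfl (Icc_subset_Icc_left ht₁.1.le)
  obtain ⟨⟨x, t⟩, ⟨hxm, htm⟩, hmax⟩ := (isCompact_Icc.prod isCompact_Icc).exists_isMaxOn
    (s := Icc 0 p ×ˢ Icc t₁ 0) (f := fun q : ℝ × ℝ => d q.1 q.2 + ε * q.2)
    ⟨(x₁, t₁), hx₁, ⟨le_rfl, ht₁.2.le⟩⟩ ((cont.mono hK).add (by fun_prop))
  have hmax' : ∀ y ∈ Icc 0 p, ∀ s ∈ Icc t₁ 0, d y s + ε * s ≤ d x t + ε * t :=
    fun y hy s hs => hmax (a := (y, s)) ⟨hy, hs⟩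
  simp only at hxm htm
  have hgt : 0 < d x t + ε * t := by
    have := hmax' x₁ hx₁ t₁ ⟨le_rfl, ht₁.2.le⟩
    linarith
  have ht0 : t < 0 := by
    refine lt_of_le_of_ne htm.2 ?_
    rintro rfl
    linarith [h0 x hxm]
  have htT : t ∈ Ioo (-T) 0 := ⟨lt_of_lt_of_le ht₁.1 htm.1, ht0⟩
  have hεt0 : ε * t < 0 := mul_neg_of_pos_of_neg hε0 ht0
  have hxI : x ∈ Ioo 0 p := by
    refine ⟨lt_of_le_of_ne hxm.1 ?_, lt_of_le_of_ne hxm.2 ?_⟩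
    · rintro rfl
      linarith [hl t htT]
    · rintro rfl
      linarith [hr t htT]
  have e1 : dt x t + ε ≤ 0 := by
    refine deriv_nonpos_of_le_right (f := fun s => d x s + ε * s) (t := t)
      (((ht x hxI t htT).add ((hasDerivAt_id t).const_mul ε)).congr_deriv (by simp)) ?_
    filter_upwards [Ioo_mem_nhdsGT ht0] with s hs
    exact hmax' x hxm s ⟨htm.1.trans hs.1.le, hs.2.le⟩
  have e2 : dxx x t ≤ 0 := by
    refine IsLocalMax.second_deriv_nonpos (f := fun y => d y t) ?_ ?_ (hxx x hxI t htT)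
    · filter_upwards [isOpen_Ioo.mem_nhds hxI] with y hy
      linarith [hmax' y (Ioo_subset_Icc_self hy) t htm]
    · filter_upwards [isOpen_Ioo.mem_nhds hxI] with y hy using hx y hy t htT
  linarith [hsub x hxI t htT]

theorem false_of_second_deriv_tendsto_neg {z z₁ z₂ : ℝ → ℝ} {δ l μ : ℝ} (hδ : 0 < δ)
    (cont : ContinuousOn z (Icc (-δ) 0)) (hz : ∀ t ∈ Ioo (-δ) 0, HasDerivAt z (z₁ t) t)
    (hz₁ : ∀ t ∈ Ioo (-δ) 0, HasDerivAt z₁ (z₂ t) t) (hl : Tendsto z₁ (𝓝[<] 0) (𝓝 l))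
    (hμ : Tendsto z₂ (𝓝[<] 0) (𝓝 μ)) (hμ0 : μ < 0) (hlow : ∀ t ∈ Ioo (-δ) 0, z 0 ≤ z t)
    (hup : ∀ ε > 0, ∃ K, ∀ t ∈ Ioo (-δ) 0, z t ≤ z 0 - ε * t + K * t ^ 2) : False := by
  have hδ' : -δ < 0 := by linarith
  have hl0 : 0 ≤ l := by
    have hd : HasDerivWithinAt z l (Iic 0) 0 := by
      refine hasDerivWithinAt_Iic_of_tendsto_deriv (s := Ioo (-δ) 0)
        (fun s hs => (hz s hs).differentiableAt.differentiableWithinAt)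
        ((cont 0 (right_mem_Icc.2 hδ'.le)).mono Ioo_subset_Icc_self) (Ioo_mem_nhdsLT hδ') ?_
      refine hl.congr' ?_
      filter_upwards [Ioo_mem_nhdsLT hδ'] with s hs using (hz s hs).deriv.symm
    have hslope := (hasDerivWithinAt_iff_tendsto_slope' (s := Iio 0) (by simp)).1
      (hd.mono Iio_subset_Iic_self)
    refine le_of_forall_pos_le_add fun ε hε => ?_
    obtain ⟨K, hK⟩ := hup ε hε
    have hc : Tendsto (fun t : ℝ => -ε + K * t) (𝓝[<] 0) (𝓝 (-ε)) := by
      have : ContinuousAt (fun t : ℝ => -ε + K * t) 0 := by fun_prop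
      simpa using this.tendsto.mono_left nhdsWithin_le_nhds
    have : -ε ≤ l := by
      refine le_of_tendsto_of_tendsto hc hslope ?_
      filter_upwards [Ioo_mem_nhdsLT hδ'] with t ht
      rw [slope_def_field, sub_zero, le_div_iff_of_neg ht.2]
      nlinarith [hK t ht]
    linarith
  obtain ⟨η, hη, hηsub⟩ := mem_nhdsLT_iff_exists_Ioo_subset.1
    (inter_mem (hμ.eventually_lt_const hμ0) (Ioo_mem_nhdsLT hδ'))
  have hη0 : η < 0 := hη
  have hz₁anti : StrictAntiOn z₁ (Ioo η 0) := by
    refine strictAntiOn_of_hasDerivWithinAt_neg (f' := z₂) (convex_Ioo _ _)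
      (fun x hx => (hz₁ x (hηsub hx).2).continuousAt.continuousWithinAt) ?_ ?_
    all_goals
      rw [interior_Ioo]
      intro x hx
    · exact (hz₁ x (hηsub hx).2).hasDerivWithinAt
    · exact (hηsub hx).1
  have hz₁pos : ∀ t ∈ Ioo η 0, 0 < z₁ t := by
    intro t ht
    have ht2 : t / 2 ∈ Ioo η 0 := ⟨by linarith [ht.1, ht.2], by linarith [ht.2]⟩
    have h1 := hz₁anti ht ht2 (by linarith [ht.2])
    have h2 : l ≤ z₁ (t / 2) := by
      refine le_of_tendsto hl ?_
      filter_upwards [Ioo_mem_nhdsLT ht2.2] with s hs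
      exact (hz₁anti ht2 ⟨ht2.1.trans hs.1, hs.2⟩ hs.1).le
    linarith
  have hη2 : η / 2 ∈ Ioo η 0 := ⟨by linarith, by linarith⟩
  have hmono : StrictMonoOn z (Icc (η / 2) 0) := by
    refine strictMonoOn_of_hasDerivWithinAt_pos (f' := z₁) (convex_Icc _ _)
      (cont.mono (Icc_subset_Icc_left (hηsub hη2).2.1.le)) ?_ ?_
    all_goals
      rw [interior_Icc]
      intro x hx
      have hx' : x ∈ Ioo η 0 := ⟨hη2.1.trans hx.1, hx.2⟩
    · exact (hz x (hηsub hx').2).hasDerivWithinAt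
    · exact hz₁pos x hx'
  have h1 := hmono (left_mem_Icc.2 hη2.2.le) (right_mem_Icc.2 hη2.2.le) hη2.2
  linarith [hlow (η / 2) (hηsub hη2).2]

/-- `w` is continuous on `[0, p] × [-T, 0]`, satisfies the backward heat equation inside and
vanishes on the lateral boundary. -/
structure IsBackwardHeat (p T : ℝ) (w wx wt wxx wtt : ℝ → ℝ → ℝ) : Prop where
  cont : ContinuousOn (fun q : ℝ × ℝ => w q.1 q.2) (Icc 0 p ×ˢ Icc (-T) 0)
  hx : ∀ x ∈ Ioo 0 p, ∀ t ∈ Ioo (-T) 0, HasDerivAt (fun y => w y t) (wx x t) x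
  hxx : ∀ x ∈ Ioo 0 p, ∀ t ∈ Ioo (-T) 0, HasDerivAt (fun y => wx y t) (wxx x t) x
  ht : ∀ x ∈ Ioo 0 p, ∀ t ∈ Ioo (-T) 0, HasDerivAt (fun s => w x s) (wt x t) t
  htt : ∀ x ∈ Ioo 0 p, ∀ t ∈ Ioo (-T) 0, HasDerivAt (fun s => wt x s) (wtt x t) t
  heat : ∀ x ∈ Ioo 0 p, ∀ t ∈ Ioo (-T) 0, wt x t + wxx x t = 0
  left : ∀ t ∈ Ioc (-T) 0, w 0 t = 0
  right : ∀ t ∈ Ioc (-T) 0, w p t = 0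

namespace IsBackwardHeat

variable {p T : ℝ} {w wx wt wxx wtt : ℝ → ℝ → ℝ}

theorem neg (H : IsBackwardHeat p T w wx wt wxx wtt) :
    IsBackwardHeat p T (fun x t => -w x t) (fun x t => -wx x t) (fun x t => -wt x t)
      (fun x t => -wxx x t) (fun x t => -wtt x t) where
  cont := H.cont.neg
  hx x hx t ht := (H.hx x hx t ht).neg
  hxx x hx t ht := (H.hxx x hx t ht).neg
  ht x hx t ht := (H.ht x hx t ht).neg
  htt x hx t ht := (H.htt x hx t ht).neg
  heat x hx t ht := by linarith [H.heat x hx t ht]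
  left t ht := by rw [H.left t ht, neg_zero]
  right t ht := by rw [H.right t ht, neg_zero]

theorem nonpos (H : IsBackwardHeat p T w wx wt wxx wtt) (h0 : ∀ x ∈ Icc 0 p, w x 0 ≤ 0) :
    ∀ x ∈ Icc 0 p, ∀ t ∈ Ioo (-T) 0, w x t ≤ 0 :=
  backward_heat_nonpos H.cont H.hx H.hxx H.ht (fun x hx t ht => (H.heat x hx t ht).ge) h0
    (fun t ht => (H.left t ⟨ht.1, ht.2.le⟩).le) fun t ht => (H.right t ⟨ht.1, ht.2.le⟩).le

theorem continuousOn_initial (H : IsBackwardHeat p T w wx wt wxx wtt) (hT : 0 < T) :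
    ContinuousOn (fun q : ℝ × ℝ => w q.1 0) (Icc 0 p ×ˢ Icc (-T) 0) :=
  H.cont.comp (f := fun q : ℝ × ℝ => (q.1, (0 : ℝ))) (by fun_prop)
    fun q hq => ⟨hq.1, by linarith, le_rfl⟩

/-- Comparison with `w(x, 0) + t m`, where `-m` is a lower bound for `w_xx(x, 0)`. -/
theorem initial_add_mul_le (H : IsBackwardHeat p T w wx wt wxx wtt) (hT : 0 < T)
    {φ₁ φ₂ : ℝ → ℝ} {m : ℝ} (hφ₁ : ∀ x ∈ Ioo 0 p, HasDerivAt (fun y => w y 0) (φ₁ x) x)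
    (hφ₂ : ∀ x ∈ Ioo 0 p, HasDerivAt φ₁ (φ₂ x) x) (hm : 0 ≤ m)
    (hle : ∀ x ∈ Ioo 0 p, -m ≤ φ₂ x) :
    ∀ x ∈ Icc 0 p, ∀ t ∈ Ioo (-T) 0, w x 0 + t * m ≤ w x t := by
  intro x hx t ht
  have := backward_heat_nonpos (p := p) (T := T) (d := fun x t => w x 0 + t * m - w x t)
    (dx := fun x t => φ₁ x - wx x t) (dxx := fun x t => φ₂ x - wxx x t)
    (dt := fun x t => m - wt x t)
    (((H.continuousOn_initial hT).add (by fun_prop)).sub H.cont)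
    (fun x hx t ht => ((hφ₁ x hx).add_const _).sub (H.hx x hx t ht))
    (fun x hx t ht => (hφ₂ x hx).sub (H.hxx x hx t ht))
    (fun x hx t ht => ((((hasDerivAt_id t).mul_const m).const_add _).sub
      (H.ht x hx t ht)).congr_deriv (by simp))
    (fun x hx t ht => by linarith [H.heat x hx t ht, hle x hx])
    (fun x hx => by simp)
    (fun t ht => by
      simp only [H.left t ⟨ht.1, ht.2.le⟩, H.left 0 ⟨by linarith, le_rfl⟩]
      nlinarith [ht.2])
    (fun t ht => by
      simp only [H.right t ⟨ht.1, ht.2.le⟩, H.right 0 ⟨by linarith, le_rfl⟩]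
      nlinarith [ht.2]) x hx t ht
  linarith

/-- One-sided first order expansion of `w(x₀, t)` at `t = 0` in terms of `w_xx(x₀, 0)`. -/
theorem exists_le_initial (H : IsBackwardHeat p T w wx wt wxx wtt) (hT : 0 < T)
    {φ₁ φ₂ : ℝ → ℝ} (hφ₁ : ∀ x ∈ Ioo 0 p, HasDerivAt (fun y => w y 0) (φ₁ x) x)
    (hφ₂ : ∀ x ∈ Ioo 0 p, HasDerivAt φ₁ (φ₂ x) x) (hc : ContinuousOn φ₂ (Icc 0 p))
    {x₀ : ℝ} (hx₀ : x₀ ∈ Ioo 0 p) {ε : ℝ} (hε : 0 < ε) :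
    ∃ K, ∀ t ∈ Ioo (-T) 0, w x₀ t ≤ w x₀ 0 - t * (φ₂ x₀ + ε) + K * t ^ 2 := by
  obtain ⟨C, hC⟩ := isCompact_Icc.exists_bound_of_continuousOn hc
  have hC' : ∀ x ∈ Icc 0 p, φ₂ x ≤ C := fun x hx => (le_abs_self _).trans (hC x hx)
  have hCc : -C ≤ φ₂ x₀ := (abs_le.1 (hC x₀ (Ioo_subset_Icc_self hx₀))).1
  have hC0 : 0 ≤ C := (abs_nonneg _).trans (hC x₀ (Ioo_subset_Icc_self hx₀))
  have hnear : ∀ᶠ x in 𝓝 x₀, φ₂ x < φ₂ x₀ + ε :=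
    (hc.continuousAt (Icc_mem_nhds hx₀.1 hx₀.2)).eventually_lt_const (by linarith)
  obtain ⟨r, hr, hrsub⟩ := Metric.eventually_nhds_iff.1
    (hnear.and (isOpen_Ioo.mem_nhds hx₀))
  have hr0 : ¬ |0 - x₀| < r := fun h => lt_irrefl _ (hrsub h).2.1
  have hrp : ¬ |p - x₀| < r := fun h => lt_irrefl _ (hrsub h).2.2
  set K := 2 * C / r ^ 2 with hK
  have hK0 : 0 ≤ K := by positivity
  have hKr : ∀ x, ¬ |x - x₀| < r → 2 * C ≤ K * (x - x₀) ^ 2 := by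
    intro x hx
    have : r ^ 2 ≤ (x - x₀) ^ 2 := by
      rw [← sq_abs (x - x₀)]
      exact pow_le_pow_left₀ hr.le (not_lt.1 hx) 2
    calc 2 * C = K * r ^ 2 := by rw [hK]; field_simp
      _ ≤ K * (x - x₀) ^ 2 := by gcongr
  have hlat : ∀ x, ¬ |x - x₀| < r → ∀ t < 0,
      0 - (0 - t * (φ₂ x₀ + ε) + K * (t ^ 2 - (x - x₀) ^ 2 * t)) ≤ 0 := by
    intro x hx t ht
    have h1 : 0 ≤ (-t) * (φ₂ x₀ + ε + K * (x - x₀) ^ 2) :=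
      mul_nonneg (by linarith) (by linarith [hKr x hx])
    have h2 : 0 ≤ K * t ^ 2 := by positivity
    linarith
  refine ⟨K, fun t ht => ?_⟩
  have := backward_heat_nonpos (p := p) (T := T)
    (d := fun x t => w x t - (w x 0 - t * (φ₂ x₀ + ε) + K * (t ^ 2 - (x - x₀) ^ 2 * t)))
    (dx := fun x t => wx x t - (φ₁ x + K * (-(2 * (x - x₀) * t))))
    (dxx := fun x t => wxx x t - (φ₂ x + K * (-(2 * t))))
    (dt := fun x t => wt x t - (-(φ₂ x₀ + ε) + K * (2 * t - (x - x₀) ^ 2)))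
    (H.cont.sub (((H.continuousOn_initial hT).sub (by fun_prop)).add (by fun_prop)))
    (fun x hx t ht => by
      have h1 := ((((hasDerivAt_id x).sub_const x₀).pow 2).mul_const t).const_sub (t ^ 2)
      exact ((H.hx x hx t ht).sub (((hφ₁ x hx).sub_const _).add
        (h1.const_mul K))).congr_deriv (by simp))
    (fun x hx t ht => by
      have h1 := ((((hasDerivAt_id x).sub_const x₀).const_mul 2).mul_const t).neg
      exact ((H.hxx x hx t ht).sub ((hφ₂ x hx).add (h1.const_mul K))).congr_deriv (by simp))
    (fun x hx t ht => by
      have h1 := ((hasDerivAt_id t).pow 2).sub ((hasDerivAt_id t).const_mul ((x - x₀) ^ 2))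
      exact ((H.ht x hx t ht).sub ((((hasDerivAt_id t).mul_const (φ₂ x₀ + ε)).const_sub
        (w x 0)).add (h1.const_mul K))).congr_deriv (by simp))
    (fun x hx t ht => by
      have h1 := H.heat x hx t ht
      have h2 : φ₂ x ≤ φ₂ x₀ + ε + K * (x - x₀) ^ 2 := by
        by_cases h : |x - x₀| < r
        · have := (hrsub h).1
          have : 0 ≤ K * (x - x₀) ^ 2 := by positivity
          linarith
        · linarith [hKr x h, hC' x (Ioo_subset_Icc_self hx)]
      linarith)
    (fun x hx => by simp)
    (fun t ht => by
      simp only [H.left t ⟨ht.1, ht.2.le⟩, H.left 0 ⟨by linarith, le_rfl⟩]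
      exact hlat 0 hr0 t ht.2)
    (fun t ht => by
      simp only [H.right t ⟨ht.1, ht.2.le⟩, H.right 0 ⟨by linarith, le_rfl⟩]
      exact hlat p hrp t ht.2) x₀ (Ioo_subset_Icc_self hx₀) t ht
  simp only [sub_self] at this
  linarith

theorem initial_second_deriv_nonneg (H : IsBackwardHeat p T w wx wt wxx wtt) (hT : 0 < T)
    {φ₁ φ₂ : ℝ → ℝ} (hφ₁ : ∀ x ∈ Ioo 0 p, HasDerivAt (fun y => w y 0) (φ₁ x) x)
    (hφ₂ : ∀ x ∈ Ioo 0 p, HasDerivAt φ₁ (φ₂ x) x) (hc : ContinuousOn φ₂ (Icc 0 p))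
    (h0 : φ₂ 0 = 0) (hp0 : φ₂ p = 0)
    (hwt : ∀ x ∈ Ioo 0 p, ∃ l, Tendsto (wt x) (𝓝[<] 0) (𝓝 l))
    (hwtt : ∀ x ∈ Ioo 0 p, Tendsto (wtt x) (𝓝[<] 0) (𝓝 (φ₂ x))) :
    ∀ x ∈ Icc 0 p, 0 ≤ φ₂ x := by
  intro x hx
  obtain ⟨x₀, hx₀, hmin⟩ := isCompact_Icc.exists_isMinOn ⟨x, hx⟩ hc
  refine le_trans ?_ (hmin hx)
  by_contra! hneg
  have hx₀I : x₀ ∈ Ioo 0 p := by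
    refine ⟨lt_of_le_of_ne hx₀.1 ?_, lt_of_le_of_ne hx₀.2 ?_⟩
    · rintro rfl
      linarith
    · rintro rfl
      linarith
  obtain ⟨l, hl⟩ := hwt x₀ hx₀I
  have hcont : ContinuousOn (fun t => w x₀ t + φ₂ x₀ * t) (Icc (-T) 0) :=
    (H.cont.comp (f := fun t : ℝ => (x₀, t)) (by fun_prop) fun t ht => ⟨hx₀, ht⟩).add
      (by fun_prop)
  refine false_of_second_deriv_tendsto_neg (z := fun t => w x₀ t + φ₂ x₀ * t)
    (z₁ := fun t => wt x₀ t + φ₂ x₀) (z₂ := wtt x₀) hT hcont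
    (fun t ht => ((H.ht x₀ hx₀I t ht).add ((hasDerivAt_id t).const_mul _)).congr_deriv (by simp))
    (fun t ht => (H.htt x₀ hx₀I t ht).add_const _) (hl.add_const _) (hwtt x₀ hx₀I) hneg ?_ ?_
  · intro t ht
    have := H.initial_add_mul_le hT hφ₁ hφ₂ (m := -φ₂ x₀) (by linarith)
      (fun y hy => by simpa using hmin (Ioo_subset_Icc_self hy)) x₀ hx₀ t ht
    linarith
  · intro ε hε
    obtain ⟨K, hK⟩ := H.exists_le_initial hT hφ₁ hφ₂ hc hx₀I hε
    refine ⟨K, fun t ht => ?_⟩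
    have := hK t ht
    linarith

end IsBackwardHeat

/-- A continuous function on `[0, p]` that vanishes at the endpoints and whose second derivative
vanishes is zero. -/
theorem eq_zero_of_second_deriv_eq_zero {p : ℝ} {φ φ₁ : ℝ → ℝ} (hp : 0 < p)
    (hc : ContinuousOn φ (Icc 0 p)) (h0 : φ 0 = 0) (hp0 : φ p = 0)
    (hφ : ∀ x ∈ Ioo 0 p, HasDerivAt φ (φ₁ x) x) (hφ₁ : ∀ x ∈ Ioo 0 p, HasDerivAt φ₁ 0 x) :
    ∀ x ∈ Icc 0 p, φ x = 0 := by
  have hconst : ∀ x ∈ Ioo 0 p, ∀ y ∈ Ioo 0 p, φ₁ x = φ₁ y := fun x hx y hy =>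
    isOpen_Ioo.is_const_of_deriv_eq_zero isPreconnected_Ioo
      (fun z hz => (hφ₁ z hz).differentiableAt.differentiableWithinAt)
      (fun z hz => (hφ₁ z hz).deriv) hx hy
  obtain ⟨c, hcI, hc0⟩ := exists_hasDerivAt_eq_slope φ φ₁ hp hc hφ
  rw [h0, hp0, sub_self, zero_div] at hc0
  intro x hx
  rcases hx.1.eq_or_lt with rfl | hx0
  · exact h0
  obtain ⟨d, hd, hdx⟩ := exists_hasDerivAt_eq_slope φ φ₁ hx0
    (hc.mono (Icc_subset_Icc_right hx.2)) fun y hy => hφ y ⟨hy.1, hy.2.trans_le hx.2⟩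
  rw [hconst d ⟨hd.1, hd.2.trans_le hx.2⟩ c hcI, hc0, h0, sub_zero, sub_zero, eq_comm,
    div_eq_zero_iff] at hdx
  exact hdx.resolve_right hx0.ne'

/-- A function continuous on the closed rectangle and vanishing in its interior off the line
`t = 0` vanishes on the closed rectangle. -/
theorem eq_zero_of_continuousOn_of_eq_zero {p T : ℝ} {w : ℝ → ℝ → ℝ} (hp : 0 < p) (hT : 0 < T)
    (hc : ContinuousOn (fun q : ℝ × ℝ => w q.1 q.2) (Icc 0 p ×ˢ Icc (-T) T))
    (hpos : ∀ x ∈ Ioo 0 p, ∀ t ∈ Ioo 0 T, w x t = 0)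
    (hneg : ∀ x ∈ Ioo 0 p, ∀ t ∈ Ioo (-T) 0, w x t = 0) :
    ∀ x ∈ Icc 0 p, ∀ t ∈ Icc (-T) T, w x t = 0 := by
  have key : EqOn (fun q : ℝ × ℝ => w q.1 q.2) (fun _ => 0) (Icc 0 p ×ˢ Icc (-T) T) := by
    refine EqOn.of_subset_closure (s := Ioo 0 p ×ˢ (Ioo 0 T ∪ Ioo (-T) 0)) ?_ hc
      continuousOn_const ?_ ?_
    · rintro ⟨x, t⟩ ⟨hx, ht | ht⟩
      · exact hpos x hx t ht
      · exact hneg x hx t ht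
    · refine prod_mono Ioo_subset_Icc_self (union_subset ?_ ?_)
      · exact Ioo_subset_Icc_self.trans (Icc_subset_Icc_left (by linarith))
      · exact Ioo_subset_Icc_self.trans (Icc_subset_Icc_right hT.le)
    · rw [closure_prod_eq, closure_union, closure_Ioo hp.ne, closure_Ioo hT.ne,
        closure_Ioo (by linarith : -T ≠ 0), union_comm, Icc_union_Icc_eq_Icc (by linarith) hT.le]
  exact fun x hx t ht => key (mk_mem_prod hx ht)

/-- The difference of two solutions of the mixed problem with the same right-hand side solves the
homogeneous wave equation for `t > 0`. -/
theorem IsMixedSol.isWave_sub {p T : ℝ} {f u₁ u₂ : ℝ → ℝ → ℝ} (hT : 0 < T)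
    (h₁ : IsMixedSol p T f u₁) (h₂ : IsMixedSol p T f u₂) :
    IsWave p 0 T (fun x t => u₁ x t - u₂ x t)
      (fun x t => deriv (fun y => u₁ y t) x - deriv (fun y => u₂ y t) x)
      (fun x t => deriv (fun s => u₁ x s) t - deriv (fun s => u₂ x s) t)
      (fun x t => deriv (deriv fun y => u₁ y t) x - deriv (deriv fun y => u₂ y t) x) := by
  obtain ⟨c₁, d₁, -, -, x₁, -, e₁, -⟩ := h₁
  obtain ⟨c₂, d₂, -, -, x₂, -, e₂, -⟩ := h₂
  have hsub : Icc 0 p ×ˢ Icc 0 T ⊆ Icc 0 p ×ˢ Icc (-T) T :=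
    prod_mono_right (Icc_subset_Icc_left (by linarith))
  refine ⟨(c₁.sub c₂).mono hsub, fun x hx t ht => ?_, fun x hx t ht => ?_, fun x hx t ht => ?_,
    fun x hx t ht => ?_, (x₁.sub x₂).mono subset_union_left⟩
  all_goals
    obtain ⟨a₁, a₂, a₃, a₄⟩ := d₁ (x, t) (Or.inl ⟨hx, ht⟩)
    obtain ⟨b₁, b₂, b₃, b₄⟩ := d₂ (x, t) (Or.inl ⟨hx, ht⟩)
  · exact a₁.hasDerivAt.sub b₁.hasDerivAt
  · exact a₃.hasDerivAt.sub b₃.hasDerivAt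
  · exact a₂.hasDerivAt.sub b₂.hasDerivAt
  · refine (a₄.hasDerivAt.sub b₄.hasDerivAt).congr_deriv ?_
    linarith [e₁ x hx t ht, e₂ x hx t ht]

/-- The difference of two solutions of the mixed problem with the same right-hand side solves the
homogeneous backward heat equation for `t < 0`. -/
theorem IsMixedSol.isBackwardHeat_sub {p T : ℝ} {f u₁ u₂ : ℝ → ℝ → ℝ} (hT : 0 < T)
    (h₁ : IsMixedSol p T f u₁) (h₂ : IsMixedSol p T f u₂) :
    IsBackwardHeat p T (fun x t => u₁ x t - u₂ x t)
      (fun x t => deriv (fun y => u₁ y t) x - deriv (fun y => u₂ y t) x)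
      (fun x t => deriv (fun s => u₁ x s) t - deriv (fun s => u₂ x s) t)
      (fun x t => deriv (deriv fun y => u₁ y t) x - deriv (deriv fun y => u₂ y t) x)
      (fun x t => deriv (deriv fun s => u₁ x s) t - deriv (deriv fun s => u₂ x s) t) := by
  obtain ⟨c₁, d₁, -, -, -, -, -, e₁, l₁, -⟩ := h₁
  obtain ⟨c₂, d₂, -, -, -, -, -, e₂, l₂, -⟩ := h₂
  have hsub : Icc 0 p ×ˢ Icc (-T) 0 ⊆ Icc 0 p ×ˢ Icc (-T) T :=
    prod_mono_right (Icc_subset_Icc_right hT.le)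
  refine ⟨(c₁.sub c₂).mono hsub, fun x hx t ht => ?_, fun x hx t ht => ?_, fun x hx t ht => ?_,
    fun x hx t ht => ?_, fun x hx t ht => ?_, fun t ht => ?_, fun t ht => ?_⟩
  case refine_6 => rw [(l₁ t ⟨ht.1, by linarith [ht.2]⟩).1, (l₂ t ⟨ht.1, by linarith [ht.2]⟩).1,
    sub_zero]
  case refine_7 => rw [(l₁ t ⟨ht.1, by linarith [ht.2]⟩).2, (l₂ t ⟨ht.1, by linarith [ht.2]⟩).2,
    sub_zero]
  all_goals
    obtain ⟨a₁, a₂, a₃, a₄⟩ := d₁ (x, t) (Or.inr ⟨hx, ht⟩)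
    obtain ⟨b₁, b₂, b₃, b₄⟩ := d₂ (x, t) (Or.inr ⟨hx, ht⟩)
  · exact a₁.hasDerivAt.sub b₁.hasDerivAt
  · exact a₃.hasDerivAt.sub b₃.hasDerivAt
  · exact a₂.hasDerivAt.sub b₂.hasDerivAt
  · exact a₄.hasDerivAt.sub b₄.hasDerivAt
  · linarith [e₁ x hx t ht, e₂ x hx t ht]

/-- A solution of the homogeneous wave equation for `t > 0` that is glued to a solution of the
backward heat equation for `t < 0` along `t = 0`, with the first two time derivatives matching,
vanishes. -/
theorem eq_zero_of_isWave_of_isBackwardHeat {p T : ℝ} {w wx wt wxx wtt : ℝ → ℝ → ℝ}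
    (hp : 0 < p) (hT : 0 < T) (HW : IsWave p 0 T w wx wt wxx)
    (HB : IsBackwardHeat p T w wx wt wxx wtt)
    (hw0 : ∀ t ∈ Ioo 0 T, w 0 t = 0) (hwp : ∀ t ∈ Ioo 0 T, w p t = 0)
    (hwt : ∀ x ∈ Ioo 0 p, ∃ l, Tendsto (wt x) (𝓝[>] 0) (𝓝 l) ∧ Tendsto (wt x) (𝓝[<] 0) (𝓝 l))
    (hwtt : ∀ x ∈ Ioo 0 p, ∃ l, Tendsto (wxx x) (𝓝[>] 0) (𝓝 l) ∧
      Tendsto (wtt x) (𝓝[<] 0) (𝓝 l)) :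
    (∀ x ∈ Ioo 0 p, ∀ t ∈ Ioo 0 T, w x t = 0) ∧
      ∀ x ∈ Ioo 0 p, ∀ t ∈ Ioo (-T) 0, w x t = 0 := by
  obtain ⟨φ₁, φ₂, hc, h0, hp0, hφ, hχ⟩ := HW.exists_initial_deriv hp hT hw0 hwp
  have hwt' : ∀ x ∈ Ioo 0 p, ∃ l, Tendsto (wt x) (𝓝[<] 0) (𝓝 l) := fun x hx =>
    let ⟨l, hl⟩ := hwt x hx
    ⟨l, hl.2⟩
  have hwtt' : ∀ x ∈ Ioo 0 p, Tendsto (wtt x) (𝓝[<] 0) (𝓝 (φ₂ x)) := by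
    intro x hx
    obtain ⟨l, hr, hl⟩ := hwtt x hx
    have : Tendsto (wxx x) (𝓝[>] 0) (𝓝 (φ₂ x)) :=
      (hχ x hx).comp (tendsto_const_nhds.prodMk tendsto_id)
    rwa [tendsto_nhds_unique this hr]
  have hφ₂ : ∀ x ∈ Icc 0 p, φ₂ x = 0 := by
    intro x hx
    refine le_antisymm ?_ (HB.initial_second_deriv_nonneg hT (fun y hy => (hφ y hy).1)
      (fun y hy => (hφ y hy).2) hc h0 hp0 hwt' hwtt' x hx)
    have := HB.neg.initial_second_deriv_nonneg hT (φ₁ := fun y => -φ₁ y) (φ₂ := fun y => -φ₂ y)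
      (fun y hy => (hφ y hy).1.neg) (fun y hy => (hφ y hy).2.neg) hc.neg (by simp [h0])
      (by simp [hp0]) (fun y hy => (hwt' y hy).imp' _ fun l hl => hl.neg)
      (fun y hy => (hwtt' y hy).neg) x hx
    linarith
  have hcont0 : ContinuousOn (fun y => w y 0) (Icc 0 p) :=
    HW.cont.comp (f := fun y : ℝ => (y, (0 : ℝ))) (by fun_prop) fun y hy => ⟨hy, le_rfl, hT.le⟩
  have hinit : ∀ x ∈ Icc 0 p, w x 0 = 0 :=
    eq_zero_of_second_deriv_eq_zero hp hcont0 (HB.left 0 ⟨by linarith, le_rfl⟩)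
      (HB.right 0 ⟨by linarith, le_rfl⟩) (fun x hx => (hφ x hx).1)
      fun x hx => (hφ x hx).2.congr_deriv (hφ₂ x (Ioo_subset_Icc_self hx))
  have hneg : ∀ x ∈ Icc 0 p, ∀ t ∈ Ioo (-T) 0, w x t = 0 := by
    intro x hx t ht
    refine le_antisymm (HB.nonpos (fun y hy => (hinit y hy).le) x hx t ht) ?_
    have := HB.neg.nonpos (fun y hy => by simp [hinit y hy]) x hx t ht
    linarith
  refine ⟨HW.eq_zero hp hT hw0 hwp hinit (fun x hx => ?_) fun x hx => ?_,
    fun x hx => hneg x (Ioo_subset_Icc_self hx)⟩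
  · obtain ⟨l, hr, hl⟩ := hwt x hx
    have hz : Tendsto (wt x) (𝓝[<] 0) (𝓝 0) := by
      refine tendsto_const_nhds.congr' ?_
      filter_upwards [Ioo_mem_nhdsLT (by linarith : -T < 0)] with t ht
      refine ((hasDerivAt_const t (0 : ℝ)).congr_of_eventuallyEq ?_).unique (HB.ht x hx t ht)
      filter_upwards [Ioo_mem_nhds ht.1 ht.2] with s hs
      exact hneg x (Ioo_subset_Icc_self hx) s hs
    rwa [tendsto_nhds_unique hl hz] at hr
  · simpa [hφ₂ x (Ioo_subset_Icc_self hx)] using hχ x hx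

/-- Uniqueness (Theorem 1): two solutions of the boundary value problem for
the mixed parabolic-hyperbolic equation with the same right-hand side `f`
coincide on the closed rectangle. -/
theorem stmt1 (p T : ℝ) (hp : 0 < p) (hT : 0 < T) (f : ℝ → ℝ → ℝ)
    (u₁ u₂ : ℝ → ℝ → ℝ)
    (h₁ : IsMixedSol p T f u₁) (h₂ : IsMixedSol p T f u₂) :
    ∀ x ∈ Icc (0:ℝ) p, ∀ t ∈ Icc (-T) T, u₁ x t = u₂ x t := by
  have HW := h₁.isWave_sub hT h₂
  have HB := h₁.isBackwardHeat_sub hT h₂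
  obtain ⟨c₁, -, -, -, -, -, e₁, -, l₁, j₁, -⟩ := h₁
  obtain ⟨c₂, -, -, -, -, -, e₂, -, l₂, j₂, -⟩ := h₂
  have hlat : ∀ t ∈ Ioo 0 T, t ∈ Ioo (-T) T := fun t ht => ⟨by linarith [ht.1], ht.2⟩
  have key := eq_zero_of_isWave_of_isBackwardHeat hp hT HW HB
    (fun t ht => by rw [(l₁ t (hlat t ht)).1, (l₂ t (hlat t ht)).1, sub_zero])
    (fun t ht => by rw [(l₁ t (hlat t ht)).2, (l₂ t (hlat t ht)).2, sub_zero])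
    (fun x hx => ?_) (fun x hx => ?_)
  · intro x hx t ht
    exact sub_eq_zero.1
      (eq_zero_of_continuousOn_of_eq_zero hp hT (c₁.sub c₂) key.1 key.2 x hx t ht)
  · obtain ⟨-, ⟨a, ha, ha'⟩, -⟩ := j₁ x hx
    obtain ⟨-, ⟨b, hb, hb'⟩, -⟩ := j₂ x hx
    exact ⟨a - b, ha.sub hb, ha'.sub hb'⟩
  · obtain ⟨-, -, a, ha, ha'⟩ := j₁ x hx
    obtain ⟨-, -, b, hb, hb'⟩ := j₂ x hx
    refine ⟨a - b, (ha.sub hb).congr' ?_, ha'.sub hb'⟩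
    filter_upwards [Ioo_mem_nhdsGT hT] with t ht
    linarith [e₁ x hx t ht, e₂ x hx t ht]
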